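/- There exists a stationary integer-valued random vector field v on ℤ² whose divergence is equal to 1 at every vertex, almost surely. -/

import Mathlib

open MeasureTheory

/-- Shift (translate) an integer vector field on `ℤ²` by `t`; `w p b` is the
value on the edge going out of `p` rightward (`b = true`) or upward
(`b = false`). -/
def shiftF (t : ℤ × ℤ) (w : ℤ × ℤ → Bool → ℤ) : ℤ × ℤ → Bool → ℤ :=
  fun p b => w (p.1 + t.1, p.2 + t.2) b

/-- The divergence at a vertex `p` of an integer vector field on `ℤ²`:
the sum of the field over the four edges oriented out of `p`. -/
def divB (w : ℤ × ℤ → Bool → ℤ) (p : ℤ × ℤ) : ℤ :=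
  w p true + w p false - w (p.1 - 1, p.2) true - w (p.1, p.2 - 1) false

noncomputable instance padicMeas : MeasurableSpace ℤ_[2] := borel _

instance padicBorel : BorelSpace ℤ_[2] := ⟨rfl⟩

/-- Indicator that `2^n` divides `x`. -/
noncomputable def DD (n : ℕ) (x : ℤ_[2]) : ℤ := if PadicInt.toZModPow n x = 0 then 1 else 0

/-- Indicator that `x mod 2^(n+1)` is less than `2^n`. -/
noncomputable def LL (n : ℕ) (x : ℤ_[2]) : ℤ :=
  if (PadicInt.toZModPow (n + 1) x).val < 2 ^ n then 1 else 0

/-- Horizontal flow. -/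
noncomputable def AA (x y : ℤ_[2]) : ℤ :=
  -∑ n ∈ Finset.range (y.valuation + 1), 4 ^ n * DD n y * LL n x

/-- Vertical flow. -/
noncomputable def BB (x y : ℤ_[2]) : ℤ :=
  -∑ n ∈ Finset.range (x.valuation + 1), 2 * 4 ^ n * DD (n + 1) x * LL n y

lemma toZModPow_zero_iff (n : ℕ) (x : ℤ_[2]) (hx : x ≠ 0) :
    PadicInt.toZModPow n x = 0 ↔ n ≤ x.valuation := by
  rw [← RingHom.mem_ker, PadicInt.ker_toZModPow]
  exact PadicInt.mem_span_pow_iff_le_valuation x hx n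

lemma DD_eq_zero {n : ℕ} {x : ℤ_[2]} (hx : x ≠ 0) (h : x.valuation + 1 ≤ n) : DD n x = 0 := by
  unfold DD
  rw [if_neg]
  rw [toZModPow_zero_iff n x hx]
  omega

lemma AA_eq {x y : ℤ_[2]} (hy : y ≠ 0) {N : ℕ} (hN : y.valuation + 1 ≤ N) :
    AA x y = -∑ n ∈ Finset.range N, 4 ^ n * DD n y * LL n x := by
  unfold AA
  congr 1
  apply Finset.sum_subset (Finset.range_mono hN)
  intro n _ hn
  rw [Finset.mem_range, not_lt] at hn
  rw [DD_eq_zero hy hn]; ring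

lemma BB_eq {x y : ℤ_[2]} (hx : x ≠ 0) {N : ℕ} (hN : x.valuation + 1 ≤ N) :
    BB x y = -∑ n ∈ Finset.range N, 2 * 4 ^ n * DD (n + 1) x * LL n y := by
  unfold BB
  congr 1
  apply Finset.sum_subset (Finset.range_mono hN)
  intro n _ hn
  rw [Finset.mem_range, not_lt] at hn
  rw [DD_eq_zero hx (by omega)]; ring

lemma LL_diff (n : ℕ) (x : ℤ_[2]) : LL n x - LL n (x - 1) = 2 * DD (n + 1) x - DD n x := by
  have hpos : 0 < 2 ^ n := by positivity
  have h1 : PadicInt.toZModPow n x = 0 ↔ 2 ^ n ∣ (PadicInt.toZModPow (n + 1) x).val := by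
    rw [← PadicInt.cast_toZModPow n (n + 1) (Nat.le_succ n) x, ZMod.cast_eq_val,
      ZMod.natCast_eq_zero_iff]
  have h2 : PadicInt.toZModPow (n + 1) x = 0 ↔ (PadicInt.toZModPow (n + 1) x).val = 0 :=
    (ZMod.val_eq_zero _).symm
  have hlt : (PadicInt.toZModPow (n + 1) x).val < 2 ^ (n + 1) := ZMod.val_lt _
  have h3 : PadicInt.toZModPow (n + 1) (x - 1) + 1 = PadicInt.toZModPow (n + 1) x := by
    rw [map_sub, map_one]; ring
  have hlt' : (PadicInt.toZModPow (n + 1) (x - 1)).val < 2 ^ (n + 1) := ZMod.val_lt _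
  have hone : (1 : ZMod (2 ^ (n + 1))).val = 1 := by
    have : Fact (1 < 2 ^ (n + 1)) := ⟨Nat.one_lt_two_pow (by omega)⟩
    exact ZMod.val_one _
  have h4 := ZMod.val_add (PadicInt.toZModPow (n + 1) (x - 1)) 1
  rw [h3, hone] at h4
  unfold LL DD
  simp only [h1, h2]
  generalize (PadicInt.toZModPow (n + 1) x).val = a at *
  generalize (PadicInt.toZModPow (n + 1) (x - 1)).val = b at *
  clear h3 h2 h1 hone
  rw [pow_succ] at *
  generalize 2 ^ n = M at *
  have h5 : M ∣ a ↔ a = 0 ∨ a = M := by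
    constructor
    · rintro ⟨k, rfl⟩
      have : k < 2 := by nlinarith
      interval_cases k <;> simp
    · rintro (h | h) <;> simp [h]
  simp only [h5]
  by_cases hb : b + 1 = M * 2
  · rw [hb, Nat.mod_self] at h4
    subst h4
    rw [if_pos hpos, if_neg (by omega)]
    simp
  · rw [Nat.mod_eq_of_lt (by omega)] at h4
    split_ifs <;> omega

lemma div_eq_one_field {x y : ℤ_[2]} (hx : x ≠ 0) (hy : y ≠ 0) :
    AA x y + BB x y - AA (x - 1) y - BB x (y - 1) = 1 := by
  obtain ⟨N, hN⟩ : ∃ N, N = x.valuation + 1 + (y.valuation + 1) := ⟨_, rfl⟩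
  rw [AA_eq hy (N := N) (by omega), AA_eq hy (N := N) (by omega),
    BB_eq hx (N := N) (by omega), BB_eq hx (N := N) (by omega)]
  have key := Finset.sum_range_sub' (fun n => 4 ^ n * DD n x * DD n y) N
  have h0 : ∀ z, DD 0 z = 1 := by
    intro z
    unfold DD
    rw [if_pos]
    exact (Subsingleton.elim (α := ZMod 1) _ _)
  rw [DD_eq_zero hx (n := N) (by omega), h0, h0] at key
  have e : ∀ n ∈ Finset.range N, 4 ^ n * DD n x * DD n y - 4 ^ (n + 1) * DD (n + 1) x * DD (n + 1) y
      = -(4 ^ n * DD n y * LL n x) - 2 * 4 ^ n * DD (n + 1) x * LL n y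
        + 4 ^ n * DD n y * LL n (x - 1) + 2 * 4 ^ n * DD (n + 1) x * LL n (y - 1) := by
    intro n _
    have a := LL_diff n x
    have b := LL_diff n y
    rw [pow_succ]
    linear_combination 4 ^ n * DD n y * a + 2 * 4 ^ n * DD (n + 1) x * b
  rw [Finset.sum_congr rfl e] at key
  simp only [Finset.sum_add_distrib, Finset.sum_sub_distrib, Finset.sum_neg_distrib] at key
  linarith

lemma measurableSet_zero (n : ℕ) : MeasurableSet {x : ℤ_[2] | PadicInt.toZModPow n x = 0} := by
  have : {x : ℤ_[2] | PadicInt.toZModPow n x = 0} = {x | ‖x‖ ≤ (2 : ℝ) ^ (-(n : ℤ))} := by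
    ext x
    rw [Set.mem_ofPred_eq, ← RingHom.mem_ker, PadicInt.ker_toZModPow,
      ← PadicInt.norm_le_pow_iff_mem_span_pow]
    simp
  rw [this]
  exact (isClosed_le continuous_norm continuous_const).measurableSet

lemma measurable_toZ (n : ℕ) (f : ZMod (2 ^ n) → ℤ) :
    Measurable fun x : ℤ_[2] => f (PadicInt.toZModPow n x) := by
  have hs : ∀ c : ZMod (2 ^ n), MeasurableSet {x : ℤ_[2] | PadicInt.toZModPow n x = c} := by
    intro c
    have : {x : ℤ_[2] | PadicInt.toZModPow n x = c}
        = (fun x => x + (-(c.val : ℤ_[2]))) ⁻¹' {x | PadicInt.toZModPow n x = 0} := by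
      ext x
      simp [add_neg_eq_zero]
    rw [this]
    exact (measurable_add_const _) (measurableSet_zero n)
  intro s _
  have : (fun x : ℤ_[2] => f (PadicInt.toZModPow n x)) ⁻¹' s
      = ⋃ c ∈ f ⁻¹' s, {x : ℤ_[2] | PadicInt.toZModPow n x = c} := by
    ext x; simp
  rw [this]
  exact MeasurableSet.biUnion (Set.to_countable _) fun c _ => hs c

lemma measurable_DD (n : ℕ) : Measurable (DD n) :=
  measurable_toZ n (fun z => if z = 0 then 1 else 0)

lemma measurable_LL (n : ℕ) : Measurable (LL n) :=
  measurable_toZ (n + 1) (fun z => if z.val < 2 ^ n then 1 else 0)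

lemma measurable_val : Measurable (fun x : ℤ_[2] => x.valuation) := by
  apply measurable_of_Ici
  intro n
  have : (fun x : ℤ_[2] => x.valuation) ⁻¹' Set.Ici n
      = ({x : ℤ_[2] | PadicInt.toZModPow n x = 0} \ {0}) ∪ {x | x = 0 ∧ n = 0} := by
    ext x
    by_cases hx : x = 0
    · simp [hx]
    · simp [hx, toZModPow_zero_iff n x hx]
  rw [this]
  refine ((measurableSet_zero n).diff (measurableSet_singleton 0)).union ?_
  exact (measurableSet_singleton (0 : ℤ_[2])).inter (MeasurableSet.const _)

lemma measurable_select {X : Type*} [MeasurableSpace X] (f : ℕ → X → ℤ)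
    (hf : ∀ k, Measurable (f k)) (g : X → ℕ) (hg : Measurable g) :
    Measurable (fun x => f (g x) x) := by
  have h : Measurable (fun r : ℕ × X => f r.1 r.2) :=
    measurable_from_prod_countable_right hf
  exact h.comp (hg.prodMk measurable_id)

lemma measurable_comp_pair {X : Type*} [MeasurableSpace X] (F : X → X → ℤ)
    (hF : Measurable (fun q : X × X => F q.1 q.2)) (f g : X → X) (hf : Measurable f)
    (hg : Measurable g) : Measurable (fun q : X × X => F (f q.1) (g q.2)) :=
  hF.comp ((hf.comp measurable_fst).prodMk (hg.comp measurable_snd))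

lemma measurable_AA : Measurable (fun q : ℤ_[2] × ℤ_[2] => AA q.1 q.2) := by
  have hk : ∀ k : ℕ, Measurable (fun q : ℤ_[2] × ℤ_[2] =>
      -∑ n ∈ Finset.range (k + 1), 4 ^ n * DD n q.2 * LL n q.1) := by
    intro k
    apply Measurable.neg
    apply Finset.measurable_sum
    intro n _
    have h1 : Measurable (fun q : ℤ_[2] × ℤ_[2] => DD n q.2) :=
      (measurable_DD n).comp measurable_snd
    have h2 : Measurable (fun q : ℤ_[2] × ℤ_[2] => LL n q.1) :=
      (measurable_LL n).comp measurable_fst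
    exact (h1.const_mul _).mul h2
  have hv : Measurable (fun q : ℤ_[2] × ℤ_[2] => q.2.valuation) :=
    measurable_val.comp measurable_snd
  exact measurable_select _ hk _ hv

lemma measurable_BB : Measurable (fun q : ℤ_[2] × ℤ_[2] => BB q.1 q.2) := by
  have hk : ∀ k : ℕ, Measurable (fun q : ℤ_[2] × ℤ_[2] =>
      -∑ n ∈ Finset.range (k + 1), 2 * 4 ^ n * DD (n + 1) q.1 * LL n q.2) := by
    intro k
    apply Measurable.neg
    apply Finset.measurable_sum
    intro n _
    have h1 : Measurable (fun q : ℤ_[2] × ℤ_[2] => DD (n + 1) q.1) :=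
      (measurable_DD (n + 1)).comp measurable_fst
    have h2 : Measurable (fun q : ℤ_[2] × ℤ_[2] => LL n q.2) :=
      (measurable_LL n).comp measurable_snd
    exact (h1.const_mul _).mul h2
  have hv : Measurable (fun q : ℤ_[2] × ℤ_[2] => q.1.valuation) :=
    measurable_val.comp measurable_fst
  exact measurable_select _ hk _ hv

/-- The field associated to a point of `ℤ₂ × ℤ₂`. -/
noncomputable def PhiF (q : ℤ_[2] × ℤ_[2]) : ℤ × ℤ → Bool → ℤ :=
  fun p b => if b then AA (q.1 + p.1) (q.2 + p.2) else BB (q.1 + p.1) (q.2 + p.2)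

lemma measurable_PhiF : Measurable PhiF := by
  refine measurable_pi_lambda _ fun p => measurable_pi_lambda _ fun b => ?_
  cases b
  · simp only [PhiF, Bool.false_eq_true, if_false]
    exact measurable_comp_pair BB measurable_BB (fun x => x + (p.1 : ℤ_[2]))
      (fun x => x + (p.2 : ℤ_[2])) (measurable_add_const _) (measurable_add_const _)
  · simp only [PhiF, if_true]
    exact measurable_comp_pair AA measurable_AA (fun x => x + (p.1 : ℤ_[2]))
      (fun x => x + (p.2 : ℤ_[2])) (measurable_add_const _) (measurable_add_const _)

lemma measurable_shiftF (t : ℤ × ℤ) : Measurable (shiftF t) := by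
  refine measurable_pi_lambda _ fun p => measurable_pi_lambda _ fun b => ?_
  exact (measurable_pi_apply b).comp (measurable_pi_apply (p.1 + t.1, p.2 + t.2))

lemma exists_haar : ∃ μ : Measure ℤ_[2], IsProbabilityMeasure μ ∧
    (∀ c : ℤ_[2], MeasurePreserving (fun x => x + c) μ μ) ∧ ∀ c : ℤ_[2], μ {c} = 0 := by
  let μ : Measure ℤ_[2] := Measure.addHaarMeasure ⊤
  have hp : IsProbabilityMeasure μ := ⟨by
    have := Measure.addHaarMeasure_self (K₀ := (⊤ : TopologicalSpace.PositiveCompacts ℤ_[2]))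
    simpa using this⟩
  refine ⟨μ, hp, fun c => measurePreserving_add_right μ c, ?_⟩
  intro c
  have hall : ∀ n : ℕ, μ {(n : ℤ_[2])} = μ {c} := by
    intro n
    have := (measurePreserving_add_right μ ((n : ℤ_[2]) - c)).measure_preimage
      (measurableSet_singleton (n : ℤ_[2])).nullMeasurableSet
    rw [← this]
    congr 1
    ext x
    simp only [Set.mem_preimage, Set.mem_singleton_iff]
    constructor
    · intro h; linear_combination h
    · rintro rfl; ring
  by_contra hne
  have h1 : μ (⋃ n : ℕ, {(n : ℤ_[2])}) = ∑' n : ℕ, μ {(n : ℤ_[2])} := by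
    apply measure_iUnion
    · intro i j hij
      simpa [Function.onFun] using hij
    · intro i; exact measurableSet_singleton _
  simp only [hall] at h1
  rw [ENNReal.tsum_const_eq_top_of_ne_zero hne] at h1
  exact measure_ne_top μ _ h1

/-- There exists a stationary integer-valued random vector field on `ℤ²`
(described by its law `μ`, a shift-invariant probability measure on the space
of integer vector fields) whose divergence equals `1` at every vertex,
almost surely. -/
theorem exists_stationary_field_divergence_one :
    ∃ μ : Measure (ℤ × ℤ → Bool → ℤ), IsProbabilityMeasure μ ∧
      (∀ t : ℤ × ℤ, Measure.map (shiftF t) μ = μ) ∧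
      (∀ᵐ w ∂μ, ∀ p : ℤ × ℤ, divB w p = 1) := by
  obtain ⟨ν, hν, hinv, hat⟩ := exists_haar
  refine ⟨Measure.map PhiF (ν.prod ν),
    Measure.isProbabilityMeasure_map measurable_PhiF.aemeasurable, ?_, ?_⟩
  · intro t
    have htr := (hinv (t.1 : ℤ_[2])).prod (hinv (t.2 : ℤ_[2]))
    rw [Measure.map_map (measurable_shiftF t) measurable_PhiF]
    have : shiftF t ∘ PhiF = PhiF ∘ Prod.map (fun x => x + (t.1 : ℤ_[2]))
        (fun x => x + (t.2 : ℤ_[2])) := by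
      funext q p b
      simp only [Function.comp, shiftF, PhiF, Prod.map]
      push_cast
      rw [show q.1 + ((p.1 : ℤ_[2]) + t.1) = q.1 + t.1 + p.1 by ring,
        show q.2 + ((p.2 : ℤ_[2]) + t.2) = q.2 + t.2 + p.2 by ring]
    rw [this, ← Measure.map_map measurable_PhiF htr.measurable, htr.map_eq]
  · have hm : MeasurableSet {w : ℤ × ℤ → Bool → ℤ | ∀ p : ℤ × ℤ, divB w p = 1} := by
      rw [Set.ofPred_forall]
      refine MeasurableSet.iInter fun p => ?_
      have hw : ∀ (q : ℤ × ℤ) (b : Bool), Measurable fun w : ℤ × ℤ → Bool → ℤ => w q b :=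
        fun q b => (measurable_pi_apply b).comp (measurable_pi_apply q)
      have : Measurable fun w : ℤ × ℤ → Bool → ℤ => divB w p :=
        (((hw _ _).add (hw _ _)).sub (hw _ _)).sub (hw _ _)
      exact this (measurableSet_singleton 1)
    rw [ae_map_iff measurable_PhiF.aemeasurable hm, ae_all_iff]
    intro p
    have hne : ∀ k : ℤ, ∀ᵐ x ∂ν, x + (k : ℤ_[2]) ≠ 0 := by
      intro k
      have : ∀ᵐ x ∂ν, x ≠ -(k : ℤ_[2]) := by
        rw [ae_iff]
        simpa using hat (-(k : ℤ_[2]))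
      filter_upwards [this] with x hx h
      exact hx (by linear_combination h)
    have h1 := (Measure.quasiMeasurePreserving_fst (μ := ν) (ν := ν)).ae (hne p.1)
    have h2 := (Measure.quasiMeasurePreserving_snd (μ := ν) (ν := ν)).ae (hne p.2)
    filter_upwards [h1, h2] with q hq1 hq2
    have := div_eq_one_field hq1 hq2
    simp only [divB, PhiF]
    push_cast
    simpa [add_sub_assoc] using this
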